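/- arXiv:cond-mat/0202356 — 2 statements merged into one kernel-verified Lean document; each statement's English description precedes it below -/
import Mathlib

section
/- Let Y and ε be independent real random variables on a probability space (Ω, 𝒜, ℙ), let β > 0 and set X = β·Y + ε. Assume: Y has a probability density P_Y with F_Y(y) < 1 and F_X(x) < 1 for all y, x; sup_{y > 0} y·P_Y(y)/F̄_Y(y) < ∞; for every x ≥ 1, lim_{t→∞} t·P_Y(t·x)/F̄_Y(t) = α·x^{−(α+1)} for some α > 0; there exist t₀ > 0, δ > 0, A > 0 with F̄_Y(t·x)/F̄_Y(t) ≤ A·x^{−δ} for all t ≥ t₀, x ≥ 1; and there exist C_Y > 0, C_ε > 0 such that y^α·F̄_Y(y) → C_Y and e^α·F̄_ε(e) → C_ε as y, e → ∞. Then the coefficient of upper tail dependence of (X, Y) exists and equals λ₊ = 1/(1 + β^{−α}·C_ε/C_Y). -/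
open MeasureTheory ProbabilityTheory Filter Set Topology

/-- Cumulative distribution function of a real random variable. -/
noncomputable def cdf' {Ω : Type*} [MeasureSpace Ω] (Z : Ω → ℝ) (z : ℝ) : ℝ :=
  (ℙ {ω | Z ω ≤ z}).toReal

/-- Survival function `F̄_Z = 1 - F_Z`. -/
noncomputable def surv {Ω : Type*} [MeasureSpace Ω] (Z : Ω → ℝ) (z : ℝ) : ℝ :=
  1 - cdf' Z z

/-- Generalized inverse (quantile function) `F_Z⁻¹(u) = inf {z | F_Z z ≥ u}`. -/
noncomputable def quant {Ω : Type*} [MeasureSpace Ω] (Z : Ω → ℝ) (u : ℝ) : ℝ :=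
  sInf {z : ℝ | u ≤ cdf' Z z}

/-- Conditional probability `ℙ(A | B)`. -/
noncomputable def condP {Ω : Type*} [MeasureSpace Ω] (A B : Set Ω) : ℝ :=
  (ℙ (A ∩ B)).toReal / (ℙ B).toReal


lemma aux_cdf {Ω : Type*} [MeasureSpace Ω] [IsProbabilityMeasure (ℙ : Measure Ω)]
    (Z : Ω → ℝ) (hZ : Measurable Z) (z : ℝ) : cdf' Z z = cdf (Measure.map Z ℙ) z := by
  haveI : IsProbabilityMeasure (Measure.map Z (ℙ : Measure Ω)) :=
    Measure.isProbabilityMeasure_map hZ.aemeasurable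
  rw [cdf_eq_real, measureReal_def, Measure.map_apply hZ measurableSet_Iic]
  rfl

lemma aux_surv {Ω : Type*} [MeasureSpace Ω] [IsProbabilityMeasure (ℙ : Measure Ω)]
    (Z : Ω → ℝ) (hZ : Measurable Z) (z : ℝ) : surv Z z = (ℙ : Measure Ω).real {ω | z < Z ω} := by
  have h : {ω | z < Z ω} = {ω | Z ω ≤ z}ᶜ := by ext ω; simp
  rw [h, probReal_compl_eq_one_sub (measurableSet_le hZ measurable_const)]
  rfl

lemma aux_sandwich {ι : Type*} {l : Filter ι} {f : ι → ℝ} {L : ℝ} {g h : ℝ → ℝ}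
    (hg : Tendsto g (𝓝[>] 0) (𝓝 L)) (hh : Tendsto h (𝓝[>] 0) (𝓝 L))
    (hU : ∀ η : ℝ, 0 < η → η < 1 → ∃ U : ι → ℝ, Tendsto U l (𝓝 (g η)) ∧ ∀ᶠ i in l, f i ≤ U i)
    (hV : ∀ η : ℝ, 0 < η → η < 1 → ∃ U : ι → ℝ, Tendsto U l (𝓝 (h η)) ∧ ∀ᶠ i in l, U i ≤ f i) :
    Tendsto f l (𝓝 L) := by
  have h01 : ∀ᶠ η in 𝓝[>] (0:ℝ), 0 < η ∧ η < 1 := Ioo_mem_nhdsGT one_pos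
  rw [tendsto_order]
  constructor
  · intro a ha
    obtain ⟨η, h1, h2, h3⟩ := ((hh.eventually_const_lt ha).and h01).exists
    obtain ⟨U, hUt, hUl⟩ := hV η h2 h3
    filter_upwards [hUl, hUt.eventually_const_lt h1] with i hi hi'
    linarith
  · intro a ha
    obtain ⟨η, h1, h2, h3⟩ := ((hg.eventually_lt_const ha).and h01).exists
    obtain ⟨U, hUt, hUl⟩ := hU η h2 h3
    filter_upwards [hUl, hUt.eventually_lt_const h1] with i hi hi'
    linarith

lemma aux_scale {ι : Type*} {l : Filter ι} {S : ℝ → ℝ} {α C c : ℝ} (hc : 0 < c)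
    (hS : Tendsto (fun y : ℝ => y ^ α * S y) atTop (𝓝 C)) {x : ι → ℝ} (hx : Tendsto x l atTop) :
    Tendsto (fun i => x i ^ α * S (c * x i)) l (𝓝 (c ^ (-α) * C)) := by
  have h1 : Tendsto (fun i => c * x i) l atTop := hx.const_mul_atTop hc
  have h2 := (hS.comp h1).const_mul (c ^ (-α))
  refine h2.congr' ?_
  filter_upwards [hx.eventually_ge_atTop 0] with i hi
  simp only [Function.comp]
  rw [Real.mul_rpow hc.le hi, Real.rpow_neg hc.le]
  have : c ^ α ≠ 0 := (Real.rpow_pos_of_pos hc α).ne'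
  field_simp

lemma aux_zero {S : ℝ → ℝ} {α C : ℝ} (hα : 0 < α)
    (hS : Tendsto (fun y : ℝ => y ^ α * S y) atTop (𝓝 C)) : Tendsto S atTop (𝓝 0) := by
  have h := (tendsto_rpow_neg_atTop hα).mul hS
  rw [zero_mul] at h
  refine h.congr' ?_
  filter_upwards [eventually_gt_atTop 0] with y hy
  rw [Real.rpow_neg hy.le]
  have : y ^ α ≠ 0 := (Real.rpow_pos_of_pos hy α).ne'
  field_simp

lemma aux_lim (β α C D : ℝ) (hβ : 0 < β) (s : ℝ) :
    Tendsto (fun η : ℝ => ((1 + s * η) / β) ^ (-α) * C + (1 + s * η) ^ (-α) * D) (𝓝[>] 0)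
      (𝓝 (β ^ α * C + D)) := by
  have hc : Tendsto (fun η : ℝ => 1 + s * η) (𝓝[>] 0) (𝓝 1) := by
    have : Continuous (fun η : ℝ => 1 + s * η) := by fun_prop
    have h := (this.tendsto 0).mono_left (nhdsWithin_le_nhds (s := Ioi 0))
    simpa using h
  have h1 : Tendsto (fun η : ℝ => (1 + s * η) ^ (-α)) (𝓝[>] 0) (𝓝 1) := by
    have := hc.rpow_const (p := -α) (Or.inl one_ne_zero)
    simpa using this
  have h2 : Tendsto (fun η : ℝ => ((1 + s * η) / β) ^ (-α)) (𝓝[>] 0) (𝓝 (β ^ α)) := by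
    have := (hc.div_const β).rpow_const (p := -α) (Or.inl (by positivity))
    rwa [one_div, Real.inv_rpow hβ.le, Real.rpow_neg hβ.le, inv_inv] at this
  simpa using (h2.mul_const C).add (h1.mul_const D)

lemma aux_quant {Ω : Type*} [MeasureSpace Ω] [IsProbabilityMeasure (ℙ : Measure Ω)]
    (Z : Ω → ℝ) (hZ : Measurable Z) (hF : ∀ z, cdf' Z z < 1) (α C : ℝ)
    (ht : Tendsto (fun y : ℝ => y ^ α * surv Z y) atTop (𝓝 C)) :
    Tendsto (quant Z) (𝓝[<] 1) atTop ∧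
    Tendsto (fun u => quant Z u ^ α * (1 - u)) (𝓝[<] 1) (𝓝 C) := by
  have hmono : Monotone (cdf' Z) := by
    intro a b hab
    rw [aux_cdf Z hZ, aux_cdf Z hZ]
    exact monotone_cdf _ hab
  have hfe : cdf' Z = fun z => cdf (Measure.map Z ℙ) z := funext (aux_cdf Z hZ)
  have hbot : Tendsto (cdf' Z) atBot (𝓝 0) := by
    rw [hfe]; exact tendsto_cdf_atBot _
  have htop : Tendsto (cdf' Z) atTop (𝓝 1) := by
    rw [hfe]; exact tendsto_cdf_atTop _
  have hrc : ∀ z, ContinuousWithinAt (cdf' Z) (Ici z) z := by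
    intro z; rw [hfe]; exact (cdf (Measure.map Z ℙ)).right_continuous z
  have hne : ∀ u < 1, {z : ℝ | u ≤ cdf' Z z}.Nonempty := by
    intro u hu
    obtain ⟨z, hz⟩ := (htop.eventually_const_lt hu).exists
    exact ⟨z, hz.le⟩
  have hbd : ∀ u > 0, BddBelow {z : ℝ | u ≤ cdf' Z z} := by
    intro u hu
    obtain ⟨m, hm⟩ := (hbot.eventually_lt_const hu).exists
    refine ⟨m, fun z hz => ?_⟩
    by_contra hlt
    have := hmono (not_le.1 hlt).le
    have hz' : u ≤ cdf' Z z := hz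
    linarith
  have hq1 : ∀ u, 0 < u → u < 1 → u ≤ cdf' Z (quant Z u) := by
    intro u h0 h1
    have h2 : Tendsto (cdf' Z) (𝓝[>] (quant Z u)) (𝓝 (cdf' Z (quant Z u))) :=
      (hrc (quant Z u)).mono_left (nhdsWithin_mono _ Ioi_subset_Ici_self)
    refine ge_of_tendsto h2 ?_
    filter_upwards [self_mem_nhdsWithin] with z hz
    obtain ⟨w, hw, hwz⟩ := exists_lt_of_csInf_lt (hne u h1) hz
    exact le_trans hw (hmono hwz.le)
  have hq2 : ∀ u, 0 < u → ∀ z < quant Z u, cdf' Z z ≤ u := by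
    intro u h0 z hz
    by_contra hlt
    have : quant Z u ≤ z := csInf_le (hbd u h0) (not_le.1 hlt).le
    linarith
  have hqt : Tendsto (quant Z) (𝓝[<] 1) atTop := by
    rw [tendsto_atTop]
    intro M
    have : ∀ᶠ u in 𝓝[<] (1:ℝ), cdf' Z M < u ∧ u < 1 := Ioo_mem_nhdsLT (hF M)
    filter_upwards [this] with u hu
    refine le_csInf (hne u hu.2) fun z hz => ?_
    by_contra hlt
    have := hmono (not_le.1 hlt).le
    have hz' : u ≤ cdf' Z z := hz
    linarith [hu.1]
  refine ⟨hqt, ?_⟩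
  have h01 : ∀ᶠ u in 𝓝[<] (1:ℝ), 0 < u ∧ u < 1 := Ioo_mem_nhdsLT one_pos
  have hl := aux_lim 1 α 0 C one_pos (-1)
  simp only [mul_zero, zero_add] at hl
  refine aux_sandwich hl (h := fun _ => C) tendsto_const_nhds ?_ ?_
  · intro η h0 h1
    refine ⟨_, aux_scale (c := 1 + -1 * η) (by linarith) ht hqt, ?_⟩
    filter_upwards [h01, hqt.eventually_gt_atTop 0] with u hu hq
    refine mul_le_mul_of_nonneg_left ?_ (Real.rpow_nonneg hq.le _)
    have := hq2 u hu.1 ((1 + -1 * η) * quant Z u) (by nlinarith)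
    unfold surv; linarith
  · intro η h0 h1
    refine ⟨_, ht.comp hqt, ?_⟩
    filter_upwards [h01, hqt.eventually_gt_atTop 0] with u hu hq
    refine mul_le_mul_of_nonneg_left ?_ (Real.rpow_nonneg hq.le _)
    have := hq1 u hu.1 hu.2
    unfold surv; linarith

lemma aux_indep {Ω : Type*} [MeasureSpace Ω] [IsProbabilityMeasure (ℙ : Measure Ω)]
    (Y ε : Ω → ℝ) (hYm : Measurable Y) (hεm : Measurable ε) (hindep : IndepFun Y ε ℙ) (a b : ℝ) :
    (ℙ : Measure Ω).real ({ω | a < Y ω} ∩ {ω | b < ε ω}) = surv Y a * surv ε b := by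
  rw [aux_surv Y hYm, aux_surv ε hεm]
  have := hindep.measure_inter_preimage_eq_mul (Ioi a) (Ioi b) measurableSet_Ioi measurableSet_Ioi
  simp only [measureReal_def, ← ENNReal.toReal_mul]
  exact congrArg ENNReal.toReal this

lemma aux_one {Ω : Type*} [MeasureSpace Ω] [IsProbabilityMeasure (ℙ : Measure Ω)]
    (Z : Ω → ℝ) (hZ : Measurable Z) : Tendsto (surv Z) atBot (𝓝 1) := by
  have hfe : cdf' Z = fun z => cdf (Measure.map Z ℙ) z := funext (aux_cdf Z hZ)
  have hbot : Tendsto (cdf' Z) atBot (𝓝 0) := by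
    rw [hfe]; exact tendsto_cdf_atBot _
  have := hbot.const_sub 1
  rw [sub_zero] at this
  exact this

lemma aux_joint {Ω ι : Type*} [MeasureSpace Ω] [IsProbabilityMeasure (ℙ : Measure Ω)]
    (Y ε : Ω → ℝ) (hYm : Measurable Y) (hεm : Measurable ε) (hindep : IndepFun Y ε ℙ)
    (β α C D : ℝ) (hβ : 0 < β) (hα : 0 < α)
    (hY : Tendsto (fun y : ℝ => y ^ α * surv Y y) atTop (𝓝 C))
    (hε : Tendsto (fun y : ℝ => y ^ α * surv ε y) atTop (𝓝 D))
    (l : Filter ι) (x y : ι → ℝ) (hx : Tendsto x l atTop) (hy : Tendsto y l atTop)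
    (hxy : ∀ᶠ i in l, β * y i ≤ x i) :
    Tendsto (fun i => x i ^ α * (ℙ : Measure Ω).real
      ({ω | x i < β * Y ω + ε ω} ∩ {ω | y i < Y ω})) l (𝓝 (β ^ α * C)) := by
  have hlU := aux_lim β α C 0 hβ (-1)
  have hlL := aux_lim β α C 0 hβ 1
  simp only [mul_zero, add_zero] at hlU hlL
  refine aux_sandwich hlU hlL ?_ ?_
  · intro η h0 h1
    have t1 := aux_scale (c := (1 + -1 * η) / β) (div_pos (by linarith) hβ) hY hx
    have t2 := (aux_scale h0 hε hx).mul ((aux_zero hα hY).comp hy)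
    have t3 := t1.add t2
    rw [mul_zero, add_zero] at t3
    refine ⟨_, t3, ?_⟩
    filter_upwards [hx.eventually_gt_atTop 0] with i hi
    simp only [Function.comp]
    rw [mul_assoc (x i ^ α), ← mul_add]
    refine mul_le_mul_of_nonneg_left ?_ (Real.rpow_nonneg hi.le _)
    rw [mul_comm (surv ε _), ← aux_indep Y ε hYm hεm hindep, aux_surv Y hYm]
    refine le_trans (measureReal_mono ?_) (measureReal_union_le _ _)
    rintro ω ⟨hω1, hω2⟩
    simp only [mem_setOf_eq, mem_union, mem_inter_iff] at *
    by_cases hc : η * x i < ε ω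
    · exact Or.inr ⟨hω2, hc⟩
    · left
      rw [div_mul_eq_mul_div, div_lt_iff₀ hβ]
      linarith
  · intro η h0 h1
    have t1 := aux_scale (c := (1 + 1 * η) / β) (div_pos (by linarith) hβ) hY hx
    have t2 := (aux_one ε hεm).comp (hx.const_mul_atTop_of_neg (neg_lt_zero.2 h0))
    have t3 := t1.mul t2
    rw [mul_one] at t3
    refine ⟨_, t3, ?_⟩
    filter_upwards [hx.eventually_gt_atTop 0, hxy] with i hi hi2
    simp only [Function.comp]
    rw [mul_assoc (x i ^ α)]
    refine mul_le_mul_of_nonneg_left ?_ (Real.rpow_nonneg hi.le _)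
    rw [← aux_indep Y ε hYm hεm hindep]
    refine measureReal_mono ?_
    rintro ω ⟨hω1, hω2⟩
    simp only [mem_setOf_eq, mem_inter_iff] at *
    rw [div_mul_eq_mul_div, div_lt_iff₀ hβ] at hω1
    refine ⟨by linarith, ?_⟩
    have : 0 < η * x i := mul_pos h0 hi
    by_contra hc
    nlinarith

lemma aux_sum {Ω : Type*} [MeasureSpace Ω] [IsProbabilityMeasure (ℙ : Measure Ω)]
    (Y ε : Ω → ℝ) (hYm : Measurable Y) (hεm : Measurable ε) (hindep : IndepFun Y ε ℙ)
    (β α C D : ℝ) (hβ : 0 < β) (hα : 0 < α)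
    (hY : Tendsto (fun y : ℝ => y ^ α * surv Y y) atTop (𝓝 C))
    (hε : Tendsto (fun y : ℝ => y ^ α * surv ε y) atTop (𝓝 D)) :
    Tendsto (fun x : ℝ => x ^ α * (ℙ : Measure Ω).real {ω | x < β * Y ω + ε ω}) atTop
      (𝓝 (β ^ α * C + D)) := by
  have hx : Tendsto (fun x : ℝ => x) atTop atTop := tendsto_id
  refine aux_sandwich (aux_lim β α C D hβ (-1)) (aux_lim β α C D hβ 1) ?_ ?_
  · intro η h0 h1
    have t1 := aux_scale (c := (1 + -1 * η) / β) (div_pos (by linarith) hβ) hY hx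
    have t1' := aux_scale (c := (1 + -1 * η)) (by linarith) hε hx
    have t2 := (aux_scale h0 hε hx).mul
      ((aux_zero hα hY).comp (hx.const_mul_atTop (div_pos h0 hβ)))
    have t3 := (t1.add t1').add t2
    rw [mul_zero, add_zero] at t3
    refine ⟨_, t3, ?_⟩
    filter_upwards [eventually_gt_atTop 0] with x hi
    simp only [Function.comp]
    rw [mul_assoc (x ^ α), ← mul_add, ← mul_add]
    refine mul_le_mul_of_nonneg_left ?_ (Real.rpow_nonneg hi.le _)
    rw [mul_comm (surv ε _), ← aux_indep Y ε hYm hεm hindep, aux_surv Y hYm, aux_surv ε hεm]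
    refine le_trans (measureReal_mono ?_) ((measureReal_union_le _ _).trans
      (add_le_add_left (measureReal_union_le _ _) _))
    intro ω hω1
    simp only [mem_setOf_eq, mem_union, mem_inter_iff] at *
    simp only [div_mul_eq_mul_div, div_lt_iff₀ hβ]
    by_cases hc : (1 + -1 * η) * x < Y ω * β
    · exact Or.inl (Or.inl hc)
    · by_cases hd : (1 + -1 * η) * x < ε ω
      · exact Or.inl (Or.inr hd)
      · right
        constructor <;> linarith
  · intro η h0 h1
    have t1 := (aux_scale (c := (1 + 1 * η) / β) (div_pos (by linarith) hβ) hY hx).mul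
      ((aux_one ε hεm).comp (hx.const_mul_atTop_of_neg (neg_lt_zero.2 h0)))
    have t1' := (aux_scale (c := (1 + 1 * η)) (by linarith) hε hx).mul
      ((aux_one Y hYm).comp (hx.const_mul_atTop_of_neg (neg_lt_zero.2 (div_pos h0 hβ))))
    have t2 := (aux_scale (c := (1 + 1 * η)) (by linarith) hε hx).mul
      ((aux_zero hα hY).comp (hx.const_mul_atTop (r := (1 + 1 * η) / β)
        (div_pos (by linarith) hβ)))
    have t3 := (t1.add t1').sub t2
    rw [mul_zero, sub_zero, mul_one, mul_one] at t3
    refine ⟨_, t3, ?_⟩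
    filter_upwards [eventually_gt_atTop 0] with x hi
    simp only [Function.comp]
    have hηx : 0 < η * x := mul_pos h0 hi
    simp only [mul_assoc (x ^ α)]
    rw [← mul_add, ← mul_sub]
    refine mul_le_mul_of_nonneg_left ?_ (Real.rpow_nonneg hi.le _)
    simp only [mul_comm (surv ε ((1 + 1 * η) * x))]
    simp only [← aux_indep Y ε hYm hεm hindep]
    rw [sub_le_iff_le_add, ← measureReal_union_add_inter]
    · refine add_le_add (measureReal_mono ?_) (measureReal_mono ?_)
      · rintro ω (⟨h1, h2⟩ | ⟨h1, h2⟩) <;>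
        simp only [mem_setOf_eq, ← neg_div, div_mul_eq_mul_div, div_lt_iff₀ hβ] at * <;> linarith
      · rintro ω ⟨⟨h1, h2⟩, ⟨h3, h4⟩⟩
        exact ⟨h1, h4⟩
    · exact (measurableSet_lt measurable_const hYm).inter (measurableSet_lt measurable_const hεm)

/-- Tail dependence coefficient for a factor model in which the factor and the
idiosyncratic noise both have power-law upper tails with the same tail index `α`:
`λ₊ = 1/(1 + β^{-α}·C_ε/C_Y)`. -/
theorem tail_dependence_power_law
    {Ω : Type*} [MeasureSpace Ω] [IsProbabilityMeasure (ℙ : Measure Ω)]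
    (Y ε X : Ω → ℝ) (hYm : Measurable Y) (hεm : Measurable ε)
    (hindep : IndepFun Y ε ℙ)
    (β : ℝ) (hβ : 0 < β)
    (hXdef : ∀ ω, X ω = β * Y ω + ε ω)
    (hFY : ∀ y : ℝ, cdf' Y y < 1) (hFX : ∀ x : ℝ, cdf' X x < 1)
    (P_Y : ℝ → ℝ) (hPm : Measurable P_Y) (hPnn : ∀ y, 0 ≤ P_Y y)
    (hdens : Measure.map Y ℙ
      = (volume : Measure ℝ).withDensity (fun y => ENNReal.ofReal (P_Y y)))
    (hbdd : ∃ M : ℝ, ∀ y > (0:ℝ), y * P_Y y / surv Y y ≤ M)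
    (α : ℝ) (hα : 0 < α)
    (hH1 : ∀ x ≥ (1:ℝ), Tendsto (fun t => t * P_Y (t * x) / surv Y t) atTop
      (𝓝 (α * x ^ (-(α + 1)))))
    (hH2 : ∃ t₀ > (0:ℝ), ∃ δ > (0:ℝ), ∃ A > (0:ℝ),
      ∀ t ≥ t₀, ∀ x ≥ (1:ℝ), surv Y (t * x) / surv Y t ≤ A * x ^ (-δ))
    (C_Y C_ε : ℝ) (hCY : 0 < C_Y) (hCε : 0 < C_ε)
    (htailY : Tendsto (fun y : ℝ => y ^ α * surv Y y) atTop (𝓝 C_Y))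
    (htailε : Tendsto (fun e : ℝ => e ^ α * surv ε e) atTop (𝓝 C_ε)) :
    Tendsto (fun u => condP {ω | quant X u < X ω} {ω | quant Y u < Y ω})
      (𝓝[<] (1:ℝ)) (𝓝 (1 / (1 + β ^ (-α) * (C_ε / C_Y)))) := by

  have hXm : Measurable X := by
    have : X = fun ω => β * Y ω + ε ω := funext hXdef
    rw [this]; fun_prop
  set K := β ^ α * C_Y + C_ε with hK
  have hβα : 0 < β ^ α := Real.rpow_pos_of_pos hβ α
  have hKpos : 0 < K := by positivity
  have htX : Tendsto (fun x : ℝ => x ^ α * surv X x) atTop (𝓝 K) := by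
    have := aux_sum Y ε hYm hεm hindep β α C_Y C_ε hβ hα htailY htailε
    refine this.congr fun x => ?_
    rw [aux_surv X hXm]
    simp only [hXdef]
  obtain ⟨hqX, hqX'⟩ := aux_quant X hXm hFX α K htX
  obtain ⟨hqY, hqY'⟩ := aux_quant Y hYm hFY α C_Y htailY
  have h1 : ∀ᶠ u in 𝓝[<] (1:ℝ), u < 1 := self_mem_nhdsWithin
  have hratio : Tendsto (fun u => quant X u ^ α / quant Y u ^ α) (𝓝[<] 1) (𝓝 (K / C_Y)) := by
    refine (hqX'.div hqY' hCY.ne').congr' ?_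
    filter_upwards [h1] with u hu
    exact mul_div_mul_right _ _ (by linarith)
  have hlt : β ^ α < K / C_Y := by
    rw [lt_div_iff₀ hCY]; linarith
  have hxy : ∀ᶠ u in 𝓝[<] (1:ℝ), β * quant Y u ≤ quant X u := by
    filter_upwards [hratio.eventually_const_lt hlt, hqX.eventually_gt_atTop 0,
      hqY.eventually_gt_atTop 0] with u h hx hy
    rw [lt_div_iff₀ (Real.rpow_pos_of_pos hy α), ← Real.mul_rpow hβ.le hy.le] at h
    exact ((Real.rpow_lt_rpow_iff (mul_pos hβ hy).le hx.le hα).1 h).le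
  have hJ := aux_joint Y ε hYm hεm hindep β α C_Y C_ε hβ hα htailY htailε _ _ _ hqX hqY hxy
  have hG := htailY.comp hqY
  have hfin := hJ.div (hratio.mul hG) (by positivity)
  have hval : β ^ α * C_Y / (K / C_Y * C_Y) = 1 / (1 + β ^ (-α) * (C_ε / C_Y)) := by
    rw [Real.rpow_neg hβ.le, hK]
    field_simp
  rw [hval] at hfin
  refine hfin.congr' ?_
  filter_upwards [hqX.eventually_gt_atTop 0, hqY.eventually_gt_atTop 0] with u hx hy
  have hxp := Real.rpow_pos_of_pos hx α
  have hyp := Real.rpow_pos_of_pos hy α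
  simp only [Function.comp, condP, hXdef, Pi.div_apply]
  rw [aux_surv Y hYm, ← mul_assoc, div_mul_cancel₀ _ hyp.ne', mul_div_mul_left _ _ hxp.ne']
  rfl
end

section
/- Let Y and ε be independent real random variables on a probability space (Ω, 𝒜, ℙ), let β > 0 and set X = β·Y + ε. Assume: Y has a probability density P_Y with F_Y(y) < 1 and F_X(x) < 1 for all y, x; sup_{y > 0} y·P_Y(y)/F̄_Y(y) < ∞; for every x ≥ 1, lim_{t→∞} t·P_Y(t·x)/F̄_Y(t) = α_Y·x^{−(α_Y+1)}; there exist t₀ > 0, δ > 0, A > 0 with F̄_Y(t·x)/F̄_Y(t) ≤ A·x^{−δ} for all t ≥ t₀, x ≥ 1; and there exist constants C_Y > 0, C_ε > 0 and tail indices 0 < α_Y < α_ε such that y^{α_Y}·F̄_Y(y) → C_Y and e^{α_ε}·F̄_ε(e) → C_ε as y, e → ∞ (so the factor Y has a strictly fatter upper tail than the idiosyncratic noise ε). Then the coefficient of upper tail dependence of (X, Y) equals 1: lim_{u→1⁻} ℙ(X > F_X⁻¹(u) | Y > F_Y⁻¹(u)) = 1. -/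
open MeasureTheory ProbabilityTheory Filter Set Topology

section Helpers

variable {Ω : Type*} [MeasureSpace Ω] [IsProbabilityMeasure (ℙ : Measure Ω)]

lemma cdf'_eq (Z : Ω → ℝ) (hZ : Measurable Z) :
    cdf' Z = fun z => cdf (Measure.map Z ℙ) z := by
  have : IsProbabilityMeasure (Measure.map Z ℙ) := Measure.isProbabilityMeasure_map hZ.aemeasurable
  funext z
  rw [cdf_eq_real, measureReal_def, Measure.map_apply hZ measurableSet_Iic]
  rfl

lemma surv_eq (Z : Ω → ℝ) (hZ : Measurable Z) (z : ℝ) :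
    surv Z z = (ℙ : Measure Ω).real {ω | z < Z ω} := by
  have hm : MeasurableSet {ω | Z ω ≤ z} := measurableSet_le hZ measurable_const
  have h := probReal_compl_eq_one_sub (μ := (ℙ : Measure Ω)) hm
  have e : {ω | Z ω ≤ z}ᶜ = {ω | z < Z ω} := by ext ω; simp
  rw [e] at h
  rw [h]; rfl

lemma cdf'_mono (Z : Ω → ℝ) (hZ : Measurable Z) : Monotone (cdf' Z) := by
  rw [cdf'_eq Z hZ]; exact monotone_cdf _

lemma quant_bdd (Z : Ω → ℝ) (hZ : Measurable Z) {u : ℝ} (hu : 0 < u) :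
    BddBelow {z : ℝ | u ≤ cdf' Z z} := by
  have h : Tendsto (cdf' Z) atBot (𝓝 0) := by
    rw [cdf'_eq Z hZ]; exact tendsto_cdf_atBot _
  obtain ⟨m, hm⟩ := (h.eventually_lt_const hu).exists
  refine ⟨m, fun z hz => ?_⟩
  by_contra hlt
  have := cdf'_mono Z hZ (not_le.mp hlt).le
  simp only [mem_setOf_eq] at hz
  linarith

lemma quant_nonempty (Z : Ω → ℝ) (hZ : Measurable Z) {u : ℝ} (hu : u < 1) :
    {z : ℝ | u ≤ cdf' Z z}.Nonempty := by
  have : IsProbabilityMeasure (Measure.map Z ℙ) := Measure.isProbabilityMeasure_map hZ.aemeasurable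
  have h : Tendsto (cdf' Z) atTop (𝓝 1) := by
    rw [cdf'_eq Z hZ]; exact tendsto_cdf_atTop _
  obtain ⟨m, hm⟩ := (h.eventually_const_lt hu).exists
  exact ⟨m, hm.le⟩

lemma le_cdf_quant (Z : Ω → ℝ) (hZ : Measurable Z) {u : ℝ} (hu0 : 0 < u) (hu : u < 1) :
    u ≤ cdf' Z (quant Z u) := by
  have hc : ContinuousWithinAt (cdf' Z) (Ioi (quant Z u)) (quant Z u) := by
    rw [cdf'_eq Z hZ]
    exact ((cdf (Measure.map Z ℙ)).right_continuous _).mono Ioi_subset_Ici_self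
  refine ge_of_tendsto hc ?_
  filter_upwards [self_mem_nhdsWithin] with x hx
  obtain ⟨z, hz, hzx⟩ := exists_lt_of_csInf_lt (quant_nonempty Z hZ hu) hx
  exact le_trans hz (cdf'_mono Z hZ hzx.le)

lemma quant_tendsto (Z : Ω → ℝ) (hZ : Measurable Z) (hF : ∀ y : ℝ, cdf' Z y < 1) :
    Tendsto (quant Z) (𝓝[<] (1:ℝ)) atTop := by
  rw [tendsto_atTop]
  intro M
  filter_upwards [self_mem_nhdsWithin, mem_nhdsWithin_of_mem_nhds (Ioi_mem_nhds (hF M))]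
    with u hu1 hu2
  refine le_csInf (quant_nonempty Z hZ hu1) fun z hz => ?_
  by_contra hlt
  have := cdf'_mono Z hZ (not_le.mp hlt).le
  simp only [mem_setOf_eq, mem_Ioi] at hz hu2
  linarith

end Helpers

lemma scale_tail (f : ℝ → ℝ) (a C c : ℝ) (hc : 0 < c)
    (h : Tendsto (fun y : ℝ => y ^ a * f y) atTop (𝓝 C)) :
    Tendsto (fun y : ℝ => y ^ a * f (c * y)) atTop (𝓝 (c ^ (-a) * C)) := by
  have h1 := (h.comp (tendsto_id.const_mul_atTop hc)).const_mul (c ^ (-a))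
  refine h1.congr' ?_
  filter_upwards [eventually_gt_atTop 0] with y hy
  simp only [Function.comp, id]
  rw [Real.mul_rpow hc.le hy.le, Real.rpow_neg hc.le]
  have : c ^ a ≠ 0 := (Real.rpow_pos_of_pos hc a).ne'
  field_simp

lemma light_tail (f : ℝ → ℝ) (a b C c : ℝ) (hc : 0 < c) (hab : a < b)
    (h : Tendsto (fun y : ℝ => y ^ b * f y) atTop (𝓝 C)) :
    Tendsto (fun y : ℝ => y ^ a * f (c * y)) atTop (𝓝 0) := by
  have h1 := (tendsto_rpow_neg_atTop (sub_pos.mpr hab)).mul (scale_tail f b C c hc h)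
  rw [zero_mul] at h1
  refine h1.congr' ?_
  filter_upwards [eventually_gt_atTop 0] with y hy
  rw [← mul_assoc, ← Real.rpow_add hy]
  congr 2; ring

/-- When the factor `Y` has a strictly fatter upper tail than the idiosyncratic
noise `ε` (tail indices `α_Y < α_ε`), the coefficient of upper tail dependence
of `(X, Y)` equals `1`. -/
theorem tail_dependence_one_fatter_factor
    {Ω : Type*} [MeasureSpace Ω] [IsProbabilityMeasure (ℙ : Measure Ω)]
    (Y ε X : Ω → ℝ) (hYm : Measurable Y) (hεm : Measurable ε)
    (hindep : IndepFun Y ε ℙ)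
    (β : ℝ) (hβ : 0 < β)
    (hXdef : ∀ ω, X ω = β * Y ω + ε ω)
    (hFY : ∀ y : ℝ, cdf' Y y < 1) (hFX : ∀ x : ℝ, cdf' X x < 1)
    (P_Y : ℝ → ℝ) (hPm : Measurable P_Y) (hPnn : ∀ y, 0 ≤ P_Y y)
    (hdens : Measure.map Y ℙ
      = (volume : Measure ℝ).withDensity (fun y => ENNReal.ofReal (P_Y y)))
    (hbdd : ∃ M : ℝ, ∀ y > (0:ℝ), y * P_Y y / surv Y y ≤ M)
    (α_Y α_ε : ℝ) (hαY : 0 < α_Y) (hαε : α_Y < α_ε)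
    (hH1 : ∀ x ≥ (1:ℝ), Tendsto (fun t => t * P_Y (t * x) / surv Y t) atTop
      (𝓝 (α_Y * x ^ (-(α_Y + 1)))))
    (hH2 : ∃ t₀ > (0:ℝ), ∃ δ > (0:ℝ), ∃ A > (0:ℝ),
      ∀ t ≥ t₀, ∀ x ≥ (1:ℝ), surv Y (t * x) / surv Y t ≤ A * x ^ (-δ))
    (C_Y C_ε : ℝ) (hCY : 0 < C_Y) (hCε : 0 < C_ε)
    (htailY : Tendsto (fun y : ℝ => y ^ α_Y * surv Y y) atTop (𝓝 C_Y))
    (htailε : Tendsto (fun e : ℝ => e ^ α_ε * surv ε e) atTop (𝓝 C_ε)) :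
    Tendsto (fun u => condP {ω | quant X u < X ω} {ω | quant Y u < Y ω})
      (𝓝[<] (1:ℝ)) (𝓝 1) := by
  have hXm : Measurable X := by
    have : X = fun ω => β * Y ω + ε ω := funext hXdef
    rw [this]; fun_prop
  have hspos : ∀ y, 0 < surv Y y := fun y => sub_pos.mpr (hFY y)
  -- Step 1: comparison of the survival functions
  have key : ∀ η > (0:ℝ), ∀ᶠ y in atTop, surv X ((1 + 2 * η) * β * y) ≤ surv Y y := by
    intro η hη
    have t1 := scale_tail (surv Y) α_Y C_Y (1 + η) (by positivity) htailY
    have t2 := light_tail (surv ε) α_Y α_ε C_ε (η * β) (by positivity) hαε htailε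
    have t3 := t1.add t2
    have hlt : (1 + η) ^ (-α_Y) * C_Y + 0 < C_Y := by
      have : (1 + η) ^ (-α_Y) < 1 :=
        Real.rpow_lt_one_of_one_lt_of_neg (by linarith) (by linarith)
      nlinarith
    filter_upwards [t3.eventually_lt htailY hlt, eventually_gt_atTop 0] with y hy hy0
    have hp : 0 < y ^ α_Y := Real.rpow_pos_of_pos hy0 _
    have hle : surv X ((1 + 2 * η) * β * y) ≤ surv Y ((1 + η) * y) + surv ε (η * β * y) := by
      rw [surv_eq X hXm, surv_eq Y hYm, surv_eq ε hεm]
      refine le_trans (measureReal_mono ?_) (measureReal_union_le _ _)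
      intro ω hω
      simp only [mem_setOf_eq, mem_union] at hω ⊢
      rw [hXdef] at hω
      by_contra hcon
      push Not at hcon
      nlinarith [mul_le_mul_of_nonneg_left hcon.1 hβ.le, hcon.2]
    refine hle.trans ?_
    rw [← mul_add] at hy
    exact (lt_of_mul_lt_mul_left hy hp.le).le
  -- Step 2: ratio
  have ratio : ∀ c > (0:ℝ), Tendsto (fun y => surv Y (c * y) / surv Y y) atTop
      (𝓝 (c ^ (-α_Y))) := by
    intro c hc
    have h := (scale_tail (surv Y) α_Y C_Y c hc htailY).div htailY hCY.ne'
    rw [mul_div_assoc, div_self hCY.ne', mul_one] at h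
    refine h.congr' ?_
    filter_upwards [eventually_gt_atTop 0] with y hy0
    have hp : 0 < y ^ α_Y := Real.rpow_pos_of_pos hy0 _
    simp only [Pi.div_apply]
    rw [mul_div_mul_left _ _ hp.ne']
  have noise : ∀ d > (0:ℝ), Tendsto (fun y => surv ε (-(d * y))) atTop (𝓝 1) := by
    intro d hd
    have h : Tendsto (cdf' ε) atBot (𝓝 0) := by
      rw [cdf'_eq ε hεm]; exact tendsto_cdf_atBot _
    have h2 := (h.comp (tendsto_neg_atTop_atBot.comp
      (tendsto_id.const_mul_atTop hd))).const_sub 1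
    rw [sub_zero] at h2
    exact h2
  have hq := quant_tendsto Y hYm hFY
  have hle1 : ∀ u, condP {ω | quant X u < X ω} {ω | quant Y u < Y ω} ≤ 1 := by
    intro u
    refine div_le_one_of_le₀ ?_ ENNReal.toReal_nonneg
    exact ENNReal.toReal_mono (measure_ne_top _ _) (measure_mono inter_subset_right)
  rw [tendsto_order]
  refine ⟨fun r hr => ?_, fun r hr => Eventually.of_forall fun u => (hle1 u).trans_lt hr⟩
  obtain ⟨η, hη, hηr⟩ : ∃ η > (0:ℝ), r < (1 + 3 * η) ^ (-α_Y) := by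
    have hc : Tendsto (fun η : ℝ => (1 + 3 * η) ^ (-α_Y)) (𝓝[>] 0) (𝓝 1) := by
      have : ContinuousAt (fun η : ℝ => (1 + 3 * η) ^ (-α_Y)) 0 := by
        refine ContinuousAt.rpow_const (by fun_prop) (Or.inl (by norm_num))
      have h := this.tendsto
      norm_num at h
      exact h.mono_left nhdsWithin_le_nhds
    obtain ⟨η, h1, h2⟩ := ((hc.eventually_const_lt hr).and self_mem_nhdsWithin).exists
    exact ⟨η, h2, h1⟩
  have hlim := (ratio (1 + 3 * η) (by positivity)).mul (noise (η * β) (by positivity))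
  rw [mul_one] at hlim
  filter_upwards [hq.eventually (hlim.eventually_const_lt hηr), hq.eventually (key η hη),
    self_mem_nhdsWithin, mem_nhdsWithin_of_mem_nhds (Ioi_mem_nhds (zero_lt_one' ℝ)),
    hq.eventually (eventually_gt_atTop 0)]
    with u h1 h2 hu1 hu0 hy0
  set y := quant Y u with hy
  have hcY : u ≤ cdf' Y y := le_cdf_quant Y hYm hu0 hu1
  have hqX : quant X u ≤ (1 + 2 * η) * β * y := by
    refine csInf_le (quant_bdd X hXm hu0) ?_
    simp only [surv] at h2
    simp only [mem_setOf_eq]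
    linarith
  refine h1.trans_le ?_
  have hden : ((ℙ : Measure Ω) {ω | y < Y ω}).toReal = surv Y y := (surv_eq Y hYm y).symm
  unfold condP
  rw [hden, div_mul_eq_mul_div]
  refine div_le_div_of_nonneg_right ?_ (hspos y).le
  have hind := hindep.measure_inter_preimage_eq_mul (Ioi ((1 + 3 * η) * y)) (Ioi (-(η * β * y)))
    measurableSet_Ioi measurableSet_Ioi
  rw [surv_eq Y hYm, surv_eq ε hεm, measureReal_def, measureReal_def, ← ENNReal.toReal_mul]
  refine le_trans (le_of_eq (congrArg ENNReal.toReal hind.symm)) ?_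
  refine ENNReal.toReal_mono (measure_ne_top _ _) (measure_mono ?_)
  rintro ω ⟨ha, hb⟩
  simp only [mem_preimage, mem_Ioi] at ha hb
  refine ⟨?_, ?_⟩
  · simp only [mem_setOf_eq]
    rw [hXdef]
    nlinarith [mul_lt_mul_of_pos_left ha hβ]
  · simp only [mem_setOf_eq]
    nlinarith [mul_pos hη hy0]
end
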